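/- Let X be a Banach space, M a metric space, M₀ ⊆ M, Γ₀ ⊆ C(M₀, X), and Γ = {γ ∈ C(M,X) : γ|_{M₀} ∈ Γ₀}. Let φ ∈ C¹(X,ℝ) satisfy c := inf_{γ∈Γ} sup_{t∈M} φ(γ(t)) > sup_{γ₀∈Γ₀} sup_{t∈M₀} φ(γ₀(t)) =: a. Let Ψ ∈ C(X,X) satisfy φ∘Ψ ≤ φ and Ψ∘γ ∈ Γ for every γ ∈ Γ. Then for every ε ∈ (0, (c−a)/2), every δ > 0, and every γ ∈ Γ with sup_M φ∘γ ≤ c+ε, there exist u, v, w ∈ X such that: c−2ε ≤ φ(u) ≤ c+2ε; c−2ε ≤ φ(v) ≤ c+2ε; ‖u−w‖ ≤ 3δ; dist(w, γ(M)) ≤ δ; ‖v−Ψ(w)‖ ≤ 2δ; ‖φ'(u)‖ < 8ε/δ; and ‖φ'(v)‖ < 8ε/δ. -/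

import Mathlib

open Filter Topology

/-- One Euler step with time budget `T`. -/
def eulerStep {X : Type*} [NormedAddCommGroup X] [NormedSpace ℝ X]
    (V : X → X) (h : X → ℝ) (T : ℝ) (p : X × ℝ) : X × ℝ :=
  (p.1 + (min (h p.1) (T - p.2)) • V p.1, p.2 + min (h p.1) (T - p.2))

/-- Continuous variable-step Euler scheme reaches the final time in locally finitely many steps. -/
theorem euler_flow {X : Type*} [NormedAddCommGroup X] [NormedSpace ℝ X] [CompleteSpace X]
    (V : X → X) (hV : Continuous V) (hV1 : ∀ x, ‖V x‖ ≤ 1)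
    (h : X → ℝ) (hh : Continuous h) (hpos : ∀ x, 0 < h x) (T : ℝ) (hT : 0 < T) :
    ∃ η : C(X, X), ∀ x, ∃ n : ℕ, (eulerStep V h T)^[n] (x, 0) = (η x, T) := by
  set F := eulerStep V h T with hF
  have hFc : Continuous F := by
    unfold eulerStep at hF
    rw [hF]
    fun_prop
  have hFT : ∀ y, F (y, T) = (y, T) := by
    intro y
    have : min (h y) (T - T) = 0 := by rw [sub_self]; exact min_eq_right (hpos y).le
    simp only [hF, eulerStep, this]
    simp
  have hFTn : ∀ y (n : ℕ), F^[n] (y, T) = (y, T) := fun y n => Function.iterate_fixed (hFT y) n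
  have hG : ∀ p : X × ℝ, T - p.2 < h p.1 → (F p).2 = T := by
    intro p hp
    simp only [hF, eulerStep, min_eq_right hp.le]
    ring
  have hle : ∀ x (n : ℕ), (F^[n] (x, 0)).2 ≤ T := by
    intro x n
    induction n with
    | zero => simpa using hT.le
    | succ n ih =>
      rw [Function.iterate_succ_apply']
      simp only [hF, eulerStep]
      have := min_le_right (h (F^[n] (x, 0)).1) (T - (F^[n] (x, 0)).2)
      simp only [hF] at this
      linarith
  have hreach : ∀ x, ∃ n : ℕ, T - (F^[n] (x, 0)).2 < h (F^[n] (x, 0)).1 := by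
    intro x
    by_contra! hcon
    set X' : ℕ → X := fun n => (F^[n] (x, 0)).1 with hX'
    set t : ℕ → ℝ := fun n => (F^[n] (x, 0)).2 with ht
    have hst : ∀ n, t (n+1) = t n + h (X' n) ∧ X' (n+1) = X' n + h (X' n) • V (X' n) := by
      intro n
      have hm : min (h (F^[n] (x, 0)).1) (T - (F^[n] (x, 0)).2) = h (F^[n] (x, 0)).1 :=
        min_eq_left (hcon n)
      simp only [ht, hX', Function.iterate_succ_apply']
      constructor
      · conv_lhs => rw [hF, eulerStep]
        rw [← hF, hm]
      · conv_lhs => rw [hF, eulerStep]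
        rw [← hF, hm]
    have hmono : Monotone t := monotone_nat_of_le_succ fun n => by
      rw [(hst n).1]; linarith [hpos (X' n)]
    obtain ⟨τ, hτ⟩ : ∃ τ, Tendsto t atTop (𝓝 τ) :=
      ⟨_, tendsto_atTop_ciSup hmono ⟨T, by rintro _ ⟨n, rfl⟩; exact hle x n⟩⟩
    have hd : ∀ n, dist (X' n) (X' (n+1)) ≤ t (n+1) - t n := by
      intro n
      rw [(hst n).1, (hst n).2, dist_self_add_right, norm_smul, Real.norm_of_nonneg (hpos _).le]
      nlinarith [hpos (X' n), hV1 (X' n)]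
    have hsum : Summable fun n => t (n+1) - t n := by
      refine summable_of_sum_range_le (c := T - t 0) (fun n => sub_nonneg.2 (hmono n.le_succ)) ?_
      intro n
      rw [Finset.sum_range_sub]
      have := hle x n
      simp only [ht]
      linarith
    have hcau : CauchySeq X' := cauchySeq_of_dist_le_of_summable _ hd hsum
    obtain ⟨y, hy⟩ := cauchySeq_tendsto_of_complete hcau
    have h1 : Tendsto (fun n => t (n+1) - t n) atTop (𝓝 (τ - τ)) :=
      (hτ.comp (tendsto_add_atTop_nat 1)).sub hτ
    have h2 : Tendsto (fun n => t (n+1) - t n) atTop (𝓝 (h y)) := by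
      have : (fun n => t (n+1) - t n) = fun n => h (X' n) := by
        funext n; rw [(hst n).1]; ring
      rw [this]
      exact (hh.tendsto y).comp hy
    have := tendsto_nhds_unique h1 h2
    linarith [hpos y]
  choose N hN using hreach
  have key : ∀ x (n : ℕ), T - (F^[n] (x, 0)).2 < h (F^[n] (x, 0)).1 →
      ∀ m, F^[n+1+m] (x, 0) = ((F^[n+1] (x, 0)).1, T) := by
    intro x n hn m
    have e : F^[n+1] (x, 0) = ((F^[n+1] (x, 0)).1, T) := by
      refine Prod.ext rfl ?_
      rw [Function.iterate_succ_apply']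
      exact hG _ hn
    rw [add_comm (n+1) m, Function.iterate_add_apply, e, hFTn]
  have key2 : ∀ x (n : ℕ), T - (F^[n] (x, 0)).2 < h (F^[n] (x, 0)).1 →
      (F^[n+1] (x, 0)).1 = (F^[N x+1] (x, 0)).1 := by
    intro x n hn
    have e1 := key x n hn (N x + 1)
    have e2 := key x (N x) (hN x) (n + 1)
    rw [add_comm] at e1
    rw [e1] at e2
    exact (Prod.ext_iff.1 e2).1
  have hit : ∀ n : ℕ, Continuous fun x : X => F^[n] (x, 0) := fun n =>
    (hFc.iterate n).comp (by fun_prop)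
  refine ⟨⟨fun x => (F^[N x+1] (x, 0)).1, ?_⟩, fun x => ⟨N x + 1, key x (N x) (hN x) 0⟩⟩
  rw [continuous_iff_continuousAt]
  intro x
  have hop : ∀ᶠ z in 𝓝 x, T - (F^[N x] (z, 0)).2 < h (F^[N x] (z, 0)).1 :=
    (isOpen_lt (continuous_const.sub (hit (N x)).snd) (hh.comp (hit (N x)).fst)).mem_nhds (hN x)
  refine ContinuousAt.congr (f := fun z => (F^[N x+1] (z, 0)).1) (hit (N x + 1)).fst.continuousAt ?_
  filter_upwards [hop] with z hz
  exact key2 z (N x) hz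

/-- Quantitative deformation lemma. -/
theorem deform {X : Type*} [NormedAddCommGroup X] [NormedSpace ℝ X] [CompleteSpace X]
    (φ : X → ℝ) (hφ : ContDiff ℝ 1 φ) (c ε δ : ℝ) (hε : 0 < ε) (hδ : 0 < δ) (S : Set X)
    (hS : ∀ u, c - 2*ε ≤ φ u → φ u ≤ c + 2*ε → (∃ x ∈ S, ‖u - x‖ ≤ 2*δ) →
      8*ε/δ ≤ ‖fderiv ℝ φ u‖) :
    ∃ η : C(X, X), (∀ x, φ (η x) ≤ φ x) ∧ (∀ x, ‖η x - x‖ ≤ δ) ∧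
      (∀ x, φ x ≤ c - 2*ε → η x = x) ∧ (∀ x ∈ S, φ x ≤ c + ε → φ (η x) ≤ c - ε) := by
  rcases S.eq_empty_or_nonempty with rfl | hSne
  · exact ⟨ContinuousMap.id X, by simp, by simp [hδ.le], by simp, by simp⟩
  have hφc : Continuous φ := hφ.continuous
  have hd : Continuous (fderiv ℝ φ) := hφ.continuous_fderiv (by norm_num)
  have hdiff : ∀ x, DifferentiableAt ℝ φ x := fun x => hφ.differentiable (by norm_num) x
  set k := ε/δ with hk
  have hkpos : 0 < k := div_pos hε hδ
  have hkδ : k * δ = ε := by rw [hk]; field_simp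
  have h8 : 8*ε/δ = 8*k := by rw [hk]; ring
  rw [h8] at hS
  -- descent direction
  obtain ⟨W, hW⟩ := exists_continuous_forall_mem_convex_of_local_const
    (t := fun x : X => {w : X | ‖w‖ ≤ 1 ∧ (8*k ≤ ‖fderiv ℝ φ x‖ → fderiv ℝ φ x w ≤ -(6*k))})
    (by
      intro x w1 h1 w2 h2 a b ha hb hab
      refine ⟨?_, fun hx => ?_⟩
      · calc ‖a • w1 + b • w2‖ ≤ ‖a • w1‖ + ‖b • w2‖ := norm_add_le _ _
          _ = a * ‖w1‖ + b * ‖w2‖ := by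
            rw [norm_smul, norm_smul, Real.norm_of_nonneg ha, Real.norm_of_nonneg hb]
          _ ≤ 1 := by nlinarith [h1.1, h2.1]
      · have e1 := h1.2 hx
        have e2 := h2.2 hx
        rw [map_add, map_smul, map_smul, smul_eq_mul, smul_eq_mul]
        obtain rfl : b = 1 - a := by linarith
        nlinarith)
    (by
      intro x
      by_cases hx : 8*k ≤ ‖fderiv ℝ φ x‖
      · obtain ⟨w, hw1, hw⟩ : ∃ w : X, ‖w‖ ≤ 1 ∧ fderiv ℝ φ x w < -(6*k) := by
          obtain ⟨w, hw1, hw⟩ := (fderiv ℝ φ x).exists_lt_apply_of_lt_opNorm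
            (r := 6*k) (by linarith)
          rw [Real.norm_eq_abs, lt_abs] at hw
          rcases hw with hw | hw
          · exact ⟨-w, by simpa using hw1.le, by rw [map_neg]; linarith⟩
          · exact ⟨w, hw1.le, by linarith⟩
        refine ⟨w, ?_⟩
        have : ∀ᶠ y in 𝓝 x, fderiv ℝ φ y w < -(6*k) :=
          (isOpen_lt (hd.clm_apply continuous_const) continuous_const).mem_nhds hw
        filter_upwards [this] with y hy
        exact ⟨hw1, fun _ => hy.le⟩
      · refine ⟨0, ?_⟩
        have : ∀ᶠ y in 𝓝 x, ‖fderiv ℝ φ y‖ < 8*k :=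
          (isOpen_lt hd.norm continuous_const).mem_nhds (not_le.1 hx)
        filter_upwards [this] with y hy
        exact ⟨by simp, fun h => absurd hy (not_lt.2 h)⟩)
  -- step size
  obtain ⟨h, hh⟩ := exists_continuous_forall_mem_convex_of_local_const
    (t := fun x : X => {r : ℝ | 0 < r ∧
      ∀ y ∈ Metric.closedBall x r, ‖fderiv ℝ φ y - fderiv ℝ φ x‖ ≤ 2*k})
    (by
      intro x
      refine Set.OrdConnected.convex ⟨fun r1 h1 r2 h2 r hr => ⟨h1.1.trans_le hr.1, fun y hy => ?_⟩⟩
      exact h2.2 y (Metric.closedBall_subset_closedBall hr.2 hy))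
    (by
      intro x
      obtain ⟨r, hr, hr'⟩ := Metric.continuousAt_iff.1 (hd.continuousAt (x := x)) k hkpos
      refine ⟨r/3, ?_⟩
      filter_upwards [Metric.ball_mem_nhds x (show 0 < r/3 by linarith)] with z hz
      refine ⟨by linarith, fun y hy => ?_⟩
      rw [Metric.mem_ball] at hz
      rw [Metric.mem_closedBall] at hy
      have e1 := hr' (show dist z x < r by linarith)
      have e2 := hr' (show dist y x < r by linarith [dist_triangle y z x])
      rw [← dist_eq_norm]
      linarith [dist_triangle_right (fderiv ℝ φ y) (fderiv ℝ φ z) (fderiv ℝ φ x)])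
  -- cutoff
  set θ : X → ℝ := fun x => max 0 (min 1 (2 - |φ x - c|/ε)) *
    max 0 (min 1 (2 - Metric.infDist x S/δ)) with hθ
  have hθc : Continuous θ := by
    have := Metric.continuous_infDist_pt S
    rw [hθ]; fun_prop
  have hθ0 : ∀ x, 0 ≤ θ x := fun x => mul_nonneg (le_max_left _ _) (le_max_left _ _)
  have hθ1 : ∀ x, θ x ≤ 1 := fun x =>
    mul_le_one₀ (max_le zero_le_one (min_le_left _ _)) (le_max_left _ _)
      (max_le zero_le_one (min_le_left _ _))
  have hθpos : ∀ x, θ x ≠ 0 → 8*k ≤ ‖fderiv ℝ φ x‖ := by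
    intro x hx
    have ha : 0 < 2 - |φ x - c|/ε := by
      by_contra! hcon
      exact hx (by simp only [hθ]; rw [max_eq_left ((min_le_right _ _).trans hcon), zero_mul])
    have hb : 0 < 2 - Metric.infDist x S/δ := by
      by_contra! hcon
      exact hx (by
        simp only [hθ]
        rw [max_eq_left ((min_le_right _ _).trans hcon : min 1 (2 - Metric.infDist x S/δ) ≤ 0),
          mul_zero])
    have ha' : |φ x - c| < 2*ε := by rw [← div_lt_iff₀ hε]; linarith
    have hb' : Metric.infDist x S < 2*δ := by rw [← div_lt_iff₀ hδ]; linarith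
    rw [abs_lt] at ha'
    obtain ⟨y, hy, hxy⟩ := (Metric.infDist_lt_iff hSne).1 hb'
    exact hS x (by linarith) (by linarith) ⟨y, hy, by rw [← dist_eq_norm]; exact hxy.le⟩
  have hθlow : ∀ x, φ x ≤ c - 2*ε → θ x = 0 := by
    intro x hx
    have : 2 ≤ |φ x - c|/ε := by
      rw [le_div_iff₀ hε]
      linarith [neg_le_abs (φ x - c)]
    simp only [hθ]
    rw [max_eq_left ((min_le_right _ _).trans (by linarith) : min 1 (2 - |φ x - c|/ε) ≤ 0),
      zero_mul]
  have hθone : ∀ x, c - ε ≤ φ x → φ x ≤ c + ε → Metric.infDist x S ≤ δ → θ x = 1 := by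
    intro x h1 h2 h3
    have e1 : |φ x - c|/ε ≤ 1 := by
      rw [div_le_one hε, abs_le]; constructor <;> linarith
    have e2 : Metric.infDist x S/δ ≤ 1 := by rwa [div_le_one hδ]
    simp only [hθ]
    rw [min_eq_left (by linarith), min_eq_left (by linarith)]
    simp
  have hVn : ∀ x, ‖θ x • W x‖ ≤ 1 := by
    intro x
    rw [norm_smul, Real.norm_of_nonneg (hθ0 x)]
    nlinarith [hθ0 x, hθ1 x, (hW x).1, norm_nonneg (W x)]
  -- descent estimate
  have hdesc : ∀ x s, 0 ≤ s → s ≤ h x → φ (x + s • (θ x • W x)) ≤ φ x - 4*k*(s*θ x) := by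
    intro x s hs0 hsh
    by_cases hx : θ x = 0
    · simp [hx]
    have h6 := (hW x).2 (hθpos x hx)
    have hn : ‖s • (θ x • W x)‖ ≤ s * θ x := by
      rw [norm_smul, norm_smul, Real.norm_of_nonneg (hθ0 x), Real.norm_of_nonneg hs0, ← mul_assoc]
      exact mul_le_of_le_one_right (mul_nonneg hs0 (hθ0 x)) (hW x).1
    have hn' : s * θ x ≤ h x := by nlinarith [hθ0 x, hθ1 x]
    have hmv := (convex_closedBall x (h x)).norm_image_sub_le_of_norm_fderiv_le'
      (f := φ) (φ := fderiv ℝ φ x) (C := 2*k) (fun y _ => hdiff y) (hh x).2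
      (Metric.mem_closedBall_self (hh x).1.le)
      (show x + s • (θ x • W x) ∈ Metric.closedBall x (h x) by
        rw [Metric.mem_closedBall, dist_eq_norm, add_sub_cancel_left]; linarith)
    rw [add_sub_cancel_left, map_smul, map_smul, smul_eq_mul, smul_eq_mul, Real.norm_eq_abs] at hmv
    have e1 := (le_abs_self _).trans hmv
    have e2 : 2*k*‖s • (θ x • W x)‖ ≤ 2*k*(s*θ x) :=
      mul_le_mul_of_nonneg_left hn (by linarith)
    have e3 : (s * θ x) * (fderiv ℝ φ x (W x)) ≤ (s * θ x) * (-(6*k)) :=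
      mul_le_mul_of_nonneg_left h6 (mul_nonneg hs0 (hθ0 x))
    linarith
  obtain ⟨η, hη⟩ := euler_flow (fun x => θ x • W x) (hθc.smul W.continuous) hVn h h.continuous
    (fun x => (hh x).1) δ hδ
  have hinv : ∀ x (n : ℕ), let p := (eulerStep (fun x => θ x • W x) h δ)^[n] (x, 0)
      p.2 ≤ δ ∧ ‖p.1 - x‖ ≤ p.2 ∧ φ p.1 ≤ φ x ∧ (φ x ≤ c - 2*ε → p.1 = x) ∧
      (x ∈ S → φ x ≤ c + ε → φ p.1 ≤ c - ε ∨ φ p.1 ≤ φ x - 4*k*p.2) := by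
    intro x n
    induction n with
    | zero => simp [hδ.le]
    | succ n ih =>
      rw [Function.iterate_succ_apply']
      generalize (eulerStep (fun x => θ x • W x) h δ)^[n] (x, 0) = p at ih
      obtain ⟨y, t⟩ := p
      obtain ⟨i1, i2, i3, i4, i5⟩ := ih
      simp only at i1 i2 i3 i4 i5
      simp only [eulerStep]
      have s1 := min_le_left (h y) (δ - t)
      have s2 := min_le_right (h y) (δ - t)
      have s0 : 0 ≤ min (h y) (δ - t) := le_min (hh y).1.le (by linarith)
      generalize min (h y) (δ - t) = s at s0 s1 s2
      have hds := hdesc y s s0 s1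
      have hnn : 0 ≤ 4*k*(s*θ y) := by have := hθ0 y; positivity
      refine ⟨by linarith, ?_, by linarith, ?_, ?_⟩
      · have : ‖s • (θ y • W y)‖ ≤ s := by
          rw [norm_smul, Real.norm_of_nonneg s0]
          exact mul_le_of_le_one_right s0 (hVn y)
        calc ‖y + s • (θ y • W y) - x‖ = ‖(y - x) + s • (θ y • W y)‖ := by congr 1; abel
          _ ≤ ‖y - x‖ + ‖s • (θ y • W y)‖ := norm_add_le _ _
          _ ≤ t + s := by linarith
      · intro hx
        rw [i4 hx, hθlow x hx]; simp
      · intro hxS hx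
        by_cases hlow : φ y ≤ c - ε
        · left; linarith
        push Not at hlow
        have h1 : θ y = 1 := by
          refine hθone y hlow.le (by linarith) ?_
          refine (Metric.infDist_le_dist_of_mem hxS).trans ?_
          rw [dist_eq_norm]; linarith
        right
        rw [h1, mul_one] at hds
        rcases i5 hxS hx with h5 | h5
        · linarith
        · rw [h1]; nlinarith
  refine ⟨η, ?_, ?_, ?_, ?_⟩
  all_goals
    intro x
    obtain ⟨n, hn⟩ := hη x
    have hi := hinv x n
    simp only [hn] at hi
    obtain ⟨i1, i2, i3, i4, i5⟩ := hi
  · exact i3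
  · exact i2
  · exact i4
  · intro hxS hx
    rcases i5 hxS hx with h5 | h5
    · exact h5
    · linarith [mul_assoc 4 k δ]

/-- The shadowing minimax principle. -/
theorem shadowing_minimax
    {X : Type*} [NormedAddCommGroup X] [NormedSpace ℝ X] [CompleteSpace X]
    {M : Type*} [MetricSpace M] (M₀ : Set M)
    (Γ₀ : Set C(M₀, X)) (Γ : Set C(M, X))
    (hΓ : Γ = {γ : C(M, X) | γ.restrict M₀ ∈ Γ₀})
    (φ : X → ℝ) (hφ : ContDiff ℝ 1 φ)
    (a c : ℝ)
    (ha : IsLUB {r : ℝ | ∃ γ₀ ∈ Γ₀, ∃ s : M₀, r = φ (γ₀ s)} a)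
    (hc : IsGLB {r : ℝ | ∃ γ ∈ Γ, IsLUB (Set.range (fun s : M => φ (γ s))) r} c)
    (hac : a < c)
    (Ψ : X → X) (hΨ : Continuous Ψ)
    (hΨφ : ∀ u : X, φ (Ψ u) ≤ φ u)
    (hΨΓ : ∀ γ ∈ Γ, (ContinuousMap.mk Ψ hΨ).comp γ ∈ Γ)
    (ε δ : ℝ) (hε : 0 < ε) (hε' : ε < (c - a) / 2) (hδ : 0 < δ)
    (γ : C(M, X)) (hγ : γ ∈ Γ) (hγc : ∀ s : M, φ (γ s) ≤ c + ε) :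
    ∃ u v w : X,
      (c - 2*ε ≤ φ u ∧ φ u ≤ c + 2*ε) ∧
      (c - 2*ε ≤ φ v ∧ φ v ≤ c + 2*ε) ∧
      ‖u - w‖ ≤ 3*δ ∧
      Metric.infDist w (Set.range γ) ≤ δ ∧
      ‖v - Ψ w‖ ≤ 2*δ ∧
      ‖fderiv ℝ φ u‖ < 8*ε/δ ∧
      ‖fderiv ℝ φ v‖ < 8*ε/δ := by
  by_contra hcon
  push Not at hcon
  have hM : Nonempty M := by
    by_contra hM
    rw [not_nonempty_iff] at hM
    have : {r : ℝ | ∃ γ ∈ Γ, IsLUB (Set.range (fun s : M => φ (γ s))) r} = ∅ := by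
      ext r
      simp only [Set.mem_setOf_eq, Set.mem_empty_iff_false, iff_false]
      rintro ⟨γ', -, hr⟩
      exact (hr.nonempty).ne_empty (Set.range_eq_empty _)
    rw [this] at hc
    exact (not_le.2 (lt_add_one c)) (hc.2 (by simp [lowerBounds]))
  have haM : ∀ γ' ∈ Γ, ∀ s ∈ M₀, φ (γ' s) ≤ c - 2*ε := by
    intro γ' hγ' s hs
    rw [hΓ] at hγ'
    have := ha.1 ⟨γ'.restrict M₀, hγ', ⟨s, hs⟩, rfl⟩
    simp only [ContinuousMap.restrict_apply] at this
    linarith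
  have hcomp : ∀ η : C(X, X), (∀ x, φ x ≤ c - 2*ε → η x = x) → ∀ γ' ∈ Γ, η.comp γ' ∈ Γ := by
    intro η hη γ' hγ'
    have h1 := haM γ' hγ'
    rw [hΓ] at hγ' ⊢
    have : (η.comp γ').restrict M₀ = γ'.restrict M₀ := by
      ext s
      exact hη _ (h1 s s.2)
    rw [Set.mem_setOf_eq, this]
    exact hγ'
  -- first deformation
  obtain ⟨η₁, a1, a2, a3, a4⟩ := deform φ hφ c ε δ hε hδ
    {x | ∀ u, c - 2*ε ≤ φ u → φ u ≤ c + 2*ε → ‖u - x‖ ≤ 2*δ → 8*ε/δ ≤ ‖fderiv ℝ φ u‖}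
    (fun u h1 h2 ⟨x, hx, hux⟩ => hx u h1 h2 hux)
  obtain ⟨η₂, b1, b2, b3, b4⟩ := deform φ hφ c ε δ hε hδ
    {x | ∀ u, c - 2*ε ≤ φ u → φ u ≤ c + 2*ε → ‖u - x‖ ≤ 2*δ → 8*ε/δ ≤ ‖fderiv ℝ φ u‖}
    (fun u h1 h2 ⟨x, hx, hux⟩ => hx u h1 h2 hux)
  have hmem := hcomp η₂ b3 _ (hΨΓ _ (hcomp η₁ a3 γ hγ))
  have hbound : ∀ s, φ (η₂ (Ψ (η₁ (γ s)))) ≤ c - ε := by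
    intro s
    by_cases hs : γ s ∈ {x | ∀ u, c - 2*ε ≤ φ u → φ u ≤ c + 2*ε → ‖u - x‖ ≤ 2*δ →
        8*ε/δ ≤ ‖fderiv ℝ φ u‖}
    · exact (b1 _).trans ((hΨφ _).trans (a4 _ hs (hγc s)))
    · simp only [Set.mem_setOf_eq] at hs
      push Not at hs
      obtain ⟨u, u1, u2, u3, u4⟩ := hs
      refine b4 _ ?_ ((hΨφ _).trans ((a1 _).trans (hγc s)))
      intro v v1 v2 v3
      refine hcon u v (η₁ (γ s)) ⟨u1, u2⟩ ⟨v1, v2⟩ ?_ ?_ v3 u4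
      · have := norm_sub_le_norm_sub_add_norm_sub u (γ s) (η₁ (γ s))
        rw [norm_sub_rev (γ s)] at this
        linarith [a2 (γ s)]
      · refine (Metric.infDist_le_dist_of_mem (Set.mem_range_self s)).trans ?_
        rw [dist_eq_norm]
        exact a2 _
  have hne : (Set.range fun s : M => φ (η₂ (Ψ (η₁ (γ s))))).Nonempty := Set.range_nonempty _
  have hub : c - ε ∈ upperBounds (Set.range fun s : M => φ (η₂ (Ψ (η₁ (γ s))))) := by
    rintro _ ⟨s, rfl⟩
    exact hbound s
  have hlub := isLUB_csSup hne ⟨_, hub⟩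
  have h1 := hc.1 ⟨_, hmem, hlub⟩
  have h2 := hlub.2 hub
  linarith
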